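/- Let (T,d,μ) be a semi-measured real tree such that μ(B) > 0 for every branch B of T. Then there exists a countable set Q ⊆ T that is dense in every proper segment of T, and for every ε > 0 there exists a compact subtree Y of T with μ(Y) > 1−ε. -/

import Mathlib

open scoped NNReal ENNReal

noncomputable section

/-- `(T,d)` is a real tree: a nonempty complete metric space in which any two distinct
points are joined by an isometric arc all of whose intermediate points separate them. -/
def IsRealTree (T : Type*) [MetricSpace T] : Prop :=
  Nonempty T ∧ CompleteSpace T ∧
    ∀ p q : T, p ≠ q → ∃ a b : ℝ, a < b ∧ ∃ α : ℝ → T,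
      (∀ s ∈ Set.Icc a b, ∀ t ∈ Set.Icc a b, dist (α s) (α t) = |s - t|) ∧
      α a = p ∧ α b = q ∧
      ∀ c : ℝ, a < c → c < b →
        connectedComponentIn ({α c}ᶜ) p ≠ connectedComponentIn ({α c}ᶜ) q

/-- `S` is the segment `[x,y]`. -/
def IsSegment {T : Type*} [MetricSpace T] (x y : T) (S : Set T) : Prop :=
  ∃ a b : ℝ, a ≤ b ∧ ∃ α : ℝ → T,
    (∀ s ∈ Set.Icc a b, ∀ t ∈ Set.Icc a b, dist (α s) (α t) = |s - t|) ∧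
    α a = x ∧ α b = y ∧ S = α '' Set.Icc a b ∧
    ∀ c : ℝ, a < c → c < b →
      connectedComponentIn ({α c}ᶜ) x ≠ connectedComponentIn ({α c}ᶜ) y

/-- `B` is a `p`-branch: a connected component of `T \ {p}`. -/
def IsBranchAt {T : Type*} [MetricSpace T] (p : T) (B : Set T) : Prop :=
  ∃ x : T, x ≠ p ∧ B = connectedComponentIn ({p}ᶜ) x

/-- `B` is a branch of `T`. -/
def IsBranch {T : Type*} [MetricSpace T] (B : Set T) : Prop :=
  ∃ p : T, IsBranchAt p B

/-- A subtree: a nonempty, closed, connected subset. -/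
def IsSubtree {T : Type*} [MetricSpace T] (Y : Set T) : Prop :=
  Y.Nonempty ∧ IsClosed Y ∧ IsPreconnected Y

/-- The sampling map `ρ_r`. -/
def rho {X : Type*} (d : X → X → ℝ) (r : ℕ) (x : Fin r → X) : Fin r → Fin r → ℝ :=
  fun i j => if i = j then 0 else d (x i) (x j)

/-- The sampling measure `τ_r(X,d,μ)`: push-forward of `μ^r` along `ρ_r`. -/
def samplingMeasure {X : Type*} [MeasurableSpace X] (d : X → X → ℝ) (r : ℕ)
    (μ : MeasureTheory.Measure X) : MeasureTheory.Measure (Fin r → Fin r → ℝ) :=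
  MeasureTheory.Measure.map (rho d r) (MeasureTheory.Measure.pi fun _ => μ)

/-- Weak convergence of a sequence of measures. -/
def WeakTendsto {Ω : Type*} [MeasurableSpace Ω] [TopologicalSpace Ω]
    (μ : ℕ → MeasureTheory.Measure Ω) (ν : MeasureTheory.Measure Ω) : Prop :=
  ∀ g : BoundedContinuousFunction Ω ℝ,
    Filter.Tendsto (fun n => ∫ x, g x ∂(μ n)) Filter.atTop (nhds (∫ x, g x ∂ν))

/-- A point `p` is an inner point if no `p`-branch has full measure. -/
def IsInnerPoint {T : Type*} [MetricSpace T] [MeasurableSpace T]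
    (μ : MeasureTheory.Measure T) (p : T) : Prop :=
  ¬ ∃ B : Set T, IsBranchAt p B ∧ μ B = 1

/-- The core: the closure of the set of inner points. -/
def treeCore {T : Type*} [MetricSpace T] [MeasurableSpace T]
    (μ : MeasureTheory.Measure T) : Set T :=
  closure {p : T | IsInnerPoint μ p}

/-- Feathers: the connected components of `T \ Core(T)`. -/
def IsFeather {T : Type*} [MetricSpace T] [MeasurableSpace T]
    (μ : MeasureTheory.Measure T) (F : Set T) : Prop :=
  ∃ x : T, x ∉ treeCore μ ∧ F = connectedComponentIn ((treeCore μ)ᶜ) x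

/-- A long dendron: a real tree together with a Borel probability measure on
`A_D = T × [0,∞)` giving positive mass to `B × [0,∞)` for every branch `B` of `T`. -/
structure LongDendron where
  carrier : Type
  [met : MetricSpace carrier]
  [meas : MeasurableSpace carrier]
  [borelSpace : BorelSpace carrier]
  isRealTree : IsRealTree carrier
  ν : MeasureTheory.Measure (carrier × ℝ≥0)
  isProb : MeasureTheory.IsProbabilityMeasure ν
  branch_pos : ∀ B : Set carrier, IsBranch B → 0 < ν (B ×ˢ Set.univ)

attribute [instance] LongDendron.met LongDendron.meas LongDendron.borelSpace

/-- `d_D((u,a),(v,b)) = d(u,v) + a + b`. -/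
def LongDendron.dD (D : LongDendron) (x y : D.carrier × ℝ≥0) : ℝ :=
  dist x.1 y.1 + (x.2 : ℝ) + (y.2 : ℝ)

/-- `τ_r(D)` for a long dendron `D`. -/
def LongDendron.samp (D : LongDendron) (r : ℕ) :
    MeasureTheory.Measure (Fin r → Fin r → ℝ) :=
  samplingMeasure D.dD r D.ν

/-- A dendron: a long dendron with `d_D ≤ 1` `ν²`-almost surely. -/
def LongDendron.IsDendron (D : LongDendron) : Prop :=
  (D.ν.prod D.ν) {x : (D.carrier × ℝ≥0) × (D.carrier × ℝ≥0) | 1 < D.dD x.1 x.2} = 0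

/-- The (combinatorial) diameter of a finite graph. -/
def graphDiam {V : Type*} [Fintype V] (G : SimpleGraph V) : ℕ :=
  Finset.sup Finset.univ fun p : V × V => G.dist p.1 p.2

/-- The shortest path distance normalized by the diameter. -/
def treeDist {V : Type*} [Fintype V] (G : SimpleGraph V) (u v : V) : ℝ :=
  (G.dist u v : ℝ) / (graphDiam G : ℝ)

/-- `τ_r(T)` for a finite tree: sampling from the uniform measure on the vertex set
with the normalized distance. -/
def treeSamp {V : Type*} [Fintype V] (G : SimpleGraph V) (r : ℕ) :
    MeasureTheory.Measure (Fin r → Fin r → ℝ) :=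
  @samplingMeasure V ⊤ (treeDist G) r
    ((Fintype.card V : ℝ≥0∞)⁻¹ • @MeasureTheory.Measure.count V ⊤)

/-- `(T,d,μ)` is an `A`-tree. -/
def IsATree {T : Type*} [MetricSpace T] [MeasurableSpace T] (n : ℕ)
    (A : Fin n → Fin n → ℝ) (μ : MeasureTheory.Measure T) : Prop :=
  ∃ q : Fin n → T,
    (∀ i j : Fin n, (if i = j then (0 : ℝ) else dist (q i) (q j)) = A i j) ∧
    (∀ Y : Set T, IsSubtree Y → (∀ i, q i ∈ Y) → Y = Set.univ) ∧
    (∀ H : Set T, MeasurableSet H →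
      μ H = ({i : Fin n | q i ∈ H}.ncard : ℝ≥0∞) / (n : ℝ≥0∞))

end

noncomputable section

/-- The associated projection `α(p) = (π(p), d(p, π(p)))` into `Core(T) × [0,∞)`,
for a given nearest-point retraction `π` onto the core. -/
def assocProj {T : Type*} [MetricSpace T] [MeasurableSpace T]
    (μ : MeasureTheory.Measure T) (π : T → T) (hπ : ∀ t, π t ∈ treeCore μ) :
    T → ↥(treeCore μ) × ℝ≥0 :=
  fun p => (⟨π p, hπ p⟩, ⟨dist p (π p), dist_nonneg⟩)

/-- The Borel σ-algebra on `Core(T) × [0,∞)` (the core carrying the restricted metric). -/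
def coreBorel {T : Type*} [MetricSpace T] [MeasurableSpace T]
    (μ : MeasureTheory.Measure T) : MeasurableSpace (↥(treeCore μ) × ℝ≥0) :=
  borel _

/-- The measure of the associated long dendron: push-forward of `μ` along the
associated projection. -/
def assocNu {T : Type*} [MetricSpace T] [MeasurableSpace T]
    (μ : MeasureTheory.Measure T) (π : T → T) (hπ : ∀ t, π t ∈ treeCore μ) :
    @MeasureTheory.Measure (↥(treeCore μ) × ℝ≥0) (coreBorel μ) :=
  letI : MeasurableSpace (↥(treeCore μ) × ℝ≥0) := coreBorel μ
  MeasureTheory.Measure.map (assocProj μ π hπ) μ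

/-- `d_D` for the associated long dendron of a semi-measured real tree. -/
def coreDD {T : Type*} [MetricSpace T] [MeasurableSpace T]
    (μ : MeasureTheory.Measure T) (x y : ↥(treeCore μ) × ℝ≥0) : ℝ :=
  dist (x.1 : T) (y.1 : T) + (x.2 : ℝ) + (y.2 : ℝ)

end

open MeasureTheory Metric Filter Topology Set
open scoped NNReal ENNReal

noncomputable section

/-- Metric betweenness. -/
def MBtw {T : Type*} [MetricSpace T] (p z q : T) : Prop :=
  dist p z + dist z q = dist p q

theorem MBtw.symm' {T : Type*} [MetricSpace T] {p z q : T} (h : MBtw p z q) : MBtw q z p := by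
  unfold MBtw at *
  rw [dist_comm q z, dist_comm z p, dist_comm q p]; linarith

theorem MBtw.trans_left {T : Type*} [MetricSpace T] {p w y k : T} (h : MBtw p w y)
    (h2 : MBtw p y k) : MBtw p w k := by
  unfold MBtw at *
  have := dist_triangle p w k
  have := dist_triangle w y k
  linarith

theorem MBtw.tail {T : Type*} [MetricSpace T] {o c w z : T} (h : MBtw o c z)
    (h2 : MBtw c w z) : MBtw o w z :=
  (h2.symm'.trans_left h.symm').symm'

/-- Same as `tail`, but gives the initial part. -/
theorem MBtw.head {T : Type*} [MetricSpace T] {o c w z : T} (h : MBtw o c z)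
    (h2 : MBtw c w z) : MBtw o c w := by
  unfold MBtw at *
  have := dist_triangle o c w
  have := dist_triangle o w z
  linarith

theorem mbtw_of_iso {T : Type*} [MetricSpace T] {a b : ℝ} {α : ℝ → T}
    (hα : ∀ s ∈ Set.Icc a b, ∀ t ∈ Set.Icc a b, dist (α s) (α t) = |s - t|)
    {r s t : ℝ} (hr : a ≤ r) (hrs : r ≤ s) (hst : s ≤ t) (ht : t ≤ b) :
    MBtw (α r) (α s) (α t) := by
  unfold MBtw
  rw [hα r ⟨hr, by linarith⟩ s ⟨by linarith, by linarith⟩,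
    hα s ⟨by linarith, by linarith⟩ t ⟨by linarith, by linarith⟩,
    hα r ⟨hr, by linarith⟩ t ⟨by linarith, by linarith⟩,
    abs_of_nonpos (by linarith), abs_of_nonpos (by linarith), abs_of_nonpos (by linarith)]
  ring

theorem cont_of_iso {T : Type*} [MetricSpace T] {a b : ℝ} {α : ℝ → T}
    (hα : ∀ s ∈ Set.Icc a b, ∀ t ∈ Set.Icc a b, dist (α s) (α t) = |s - t|) :
    ContinuousOn α (Set.Icc a b) := by
  have : LipschitzOnWith 1 α (Set.Icc a b) := by
    apply LipschitzOnWith.of_dist_le_mul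
    intro x hx y hy
    rw [hα x hx y hy, Real.dist_eq]; simp
  exact this.continuousOn

theorem exists_arc {T : Type*} [MetricSpace T] (hT : IsRealTree T) (p q : T) :
    ∃ C : Set T, IsPreconnected C ∧ IsCompact C ∧ p ∈ C ∧ q ∈ C ∧ (∀ w ∈ C, MBtw p w q) ∧
      ∀ t, 0 ≤ t → t ≤ dist p q → ∃ w ∈ C, dist p w = t := by
  by_cases hpq : p = q
  · subst hpq
    refine ⟨{p}, isPreconnected_singleton, isCompact_singleton, rfl, rfl, ?_, ?_⟩
    · rintro w rfl; simp [MBtw]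
    · intro t h0 h1
      refine ⟨p, rfl, ?_⟩
      simp only [dist_self] at h1 ⊢
      linarith
  · obtain ⟨a, b, hab, α, hα, rfl, rfl, -⟩ := hT.2.2 p q hpq
    refine ⟨α '' Icc a b, isPreconnected_Icc.image _ (cont_of_iso hα),
      isCompact_Icc.image_of_continuousOn (cont_of_iso hα),
      ⟨a, ⟨le_rfl, hab.le⟩, rfl⟩, ⟨b, ⟨hab.le, le_rfl⟩, rfl⟩, ?_, ?_⟩
    · rintro _ ⟨s, hs, rfl⟩
      exact mbtw_of_iso hα le_rfl hs.1 hs.2 le_rfl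
    · intro t h0 h1
      rw [hα a ⟨le_rfl, hab.le⟩ b ⟨hab.le, le_rfl⟩, abs_of_nonpos (by linarith)] at h1
      refine ⟨α (a + t), ⟨a + t, ⟨by linarith, by linarith⟩, rfl⟩, ?_⟩
      rw [hα a ⟨le_rfl, hab.le⟩ (a + t) ⟨by linarith, by linarith⟩,
        abs_of_nonpos (by linarith)]
      ring

theorem comp_eq_of_conn {T : Type*} [MetricSpace T] {C : Set T} (hC : IsPreconnected C)
    {p q z : T} (hp : p ∈ C) (hq : q ∈ C) (hz : z ∉ C) :
    connectedComponentIn ({z}ᶜ) p = connectedComponentIn ({z}ᶜ) q := by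
  apply connectedComponentIn_eq
  refine hC.subset_connectedComponentIn hp ?_ hq
  intro w hw h
  exact hz (h ▸ hw)

theorem comp_eq_of_not {T : Type*} [MetricSpace T] (hT : IsRealTree T) {p q z : T}
    (h : ¬ MBtw p z q) :
    connectedComponentIn ({z}ᶜ) p = connectedComponentIn ({z}ᶜ) q := by
  obtain ⟨C, hC, -, hp, hq, hB, -⟩ := exists_arc hT p q
  exact comp_eq_of_conn hC hp hq fun hz => h (hB z hz)

theorem comp_ne_of {T : Type*} [MetricSpace T] (hT : IsRealTree T) {p q z : T}
    (h : MBtw p z q) (hp : z ≠ p) (hq : z ≠ q) :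
    connectedComponentIn ({z}ᶜ) p ≠ connectedComponentIn ({z}ᶜ) q := by
  have d1 : 0 < dist p z := dist_pos.2 hp.symm
  have d2 : 0 < dist z q := dist_pos.2 hq
  have hpq : p ≠ q := by
    rintro rfl
    unfold MBtw at h
    rw [dist_self] at h; linarith
  obtain ⟨a, b, hab, α, hα, ha, hb, hsep⟩ := hT.2.2 p q hpq
  have hd : dist p q = b - a := by
    rw [← ha, ← hb, hα a ⟨le_rfl, hab.le⟩ b ⟨hab.le, le_rfl⟩, abs_of_nonpos (by linarith)]; ring
  unfold MBtw at h
  have hc1 : a < a + dist p z := by linarith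
  have hc2 : a + dist p z < b := by linarith
  have hs := hsep _ hc1 hc2
  have hw : dist p (α (a + dist p z)) = dist p z := by
    have h5 := hα a ⟨le_rfl, hab.le⟩ _ ⟨hc1.le, hc2.le⟩
    rw [ha, abs_of_nonpos (by linarith)] at h5
    linarith
  generalize α (a + dist p z) = w at hs hw
  by_cases hwz : w = z
  · rwa [hwz] at hs
  exfalso
  have d3 : 0 < dist z w := dist_pos.2 (Ne.symm hwz)
  obtain ⟨C, hC, -, hpC, hzC, hB, -⟩ := exists_arc hT p z
  obtain ⟨D, hD, -, hzD, hqD, hB', -⟩ := exists_arc hT z q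
  apply hs
  trans connectedComponentIn ({w}ᶜ) z
  · apply comp_eq_of_conn hC hpC hzC
    intro hwC
    have := hB w hwC
    unfold MBtw at this
    rw [dist_comm w z] at this; linarith
  · apply comp_eq_of_conn hD hzD hqD
    intro hwD
    have := hB' w hwD
    unfold MBtw at this
    have := dist_triangle p w q
    linarith

theorem MBtw.split {T : Type*} [MetricSpace T] (hT : IsRealTree T) {p q z : T}
    (h : MBtw p z q) (r : T) : MBtw p z r ∨ MBtw r z q := by
  by_contra! hc
  obtain ⟨h1, h2⟩ := hc
  have hp : z ≠ p := by rintro rfl; exact h1 (by simp [MBtw])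
  have hq : z ≠ q := by rintro rfl; exact h2 (by simp [MBtw])
  exact comp_ne_of hT h hp hq ((comp_eq_of_not hT h1).trans (comp_eq_of_not hT h2))

theorem MBtw.unique {T : Type*} [MetricSpace T] (hT : IsRealTree T) {p q z z' : T}
    (h : MBtw p z q) (h' : MBtw p z' q) (hd : dist p z = dist p z') : z = z' := by
  unfold MBtw at h'
  rcases MBtw.split hT h z' with h1 | h1 <;> unfold MBtw at h h1
  · exact dist_eq_zero.1 (by linarith)
  · symm; exact dist_eq_zero.1 (by linarith)

theorem not_mbtw_of_mem {T : Type*} [MetricSpace T] (hT : IsRealTree T) {p x y : T}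
    (hx : x ≠ p) (hy : y ∈ connectedComponentIn ({p}ᶜ) x) : ¬ MBtw x p y := by
  intro h
  have hyp : y ≠ p := connectedComponentIn_subset _ _ hy
  exact comp_ne_of hT h hx.symm hyp.symm (connectedComponentIn_eq hy)

/-- The countable set. -/
def Qset {T : Type*} [MetricSpace T] (o : T) : Set T :=
  ⋃ h : ℚ, {w | dist o w = h ∧ ∃ x, x ≠ w ∧ MBtw o w x}

theorem Qset_countable {T : Type} [MetricSpace T] [m : MeasurableSpace T]
    (hT : IsRealTree T) (μ : Measure T) [IsProbabilityMeasure μ]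
    (hballs : ∀ (x : T) (s : ℝ), MeasurableSet (Metric.ball x s))
    (hpos : ∀ B : Set T, IsBranch B → 0 < μ B) (o : T) : (Qset o).Countable := by
  have hmeas : ∀ x : T, Measurable fun y => dist x y := by
    intro x
    apply measurable_of_Iio
    intro s
    convert hballs x s using 1
    ext y; simp [dist_comm]
  apply Set.countable_iUnion
  intro h
  let As : {w : T // dist o w = h} → Set T := fun w => {x | x ≠ w.1 ∧ MBtw o w.1 x}
  have hc := Measure.countable_meas_pos_of_disjoint_iUnion (μ := μ) (As := As) ?_ ?_
  · refine (hc.image Subtype.val).mono ?_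
    rintro w ⟨hw, x, hxw, hB⟩
    refine ⟨⟨w, hw⟩, ?_, rfl⟩
    refine lt_of_lt_of_le (hpos _ ⟨w, x, hxw, rfl⟩) (measure_mono ?_)
    intro y hy
    refine ⟨connectedComponentIn_subset _ _ hy, ?_⟩
    have h1 := not_mbtw_of_mem hT hxw hy
    rcases hB.split hT y with h2 | h2
    · exact h2
    · exact absurd h2.symm' h1
  · intro w
    have e : As w = {x | dist w.1 x = 0}ᶜ ∩ {x | dist o w.1 + dist w.1 x = dist o x} := by
      ext x; simp [As, MBtw, eq_comm]
    rw [e]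
    exact ((hmeas _) (measurableSet_singleton 0)).compl.inter
      (measurableSet_eq_fun (measurable_const.add (hmeas _)) (hmeas _))
  · intro w w' hne
    refine Set.disjoint_left.2 ?_
    rintro x ⟨-, h1⟩ ⟨-, h2⟩
    exact hne (Subtype.ext (h1.unique hT h2 (w.2.trans w'.2.symm)))

theorem exists_mem_Qset {T : Type*} [MetricSpace T] (hT : IsRealTree T) (o : T) {z1 z2 : T}
    (hne : z1 ≠ z2) : ∃ w ∈ Qset o, MBtw z1 w z2 := by
  have key : ∀ c z : T, c ≠ z → MBtw o c z → ∃ w ∈ Qset o, MBtw c w z := by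
    intro c z hcz hB
    have d1 : 0 < dist c z := dist_pos.2 hcz
    obtain ⟨h, hh1, hh2⟩ := exists_rat_btwn (show dist o c < dist o c + dist c z by linarith)
    obtain ⟨C, -, -, -, -, hC, hCt⟩ := exists_arc hT c z
    obtain ⟨w, hwC, hw⟩ := hCt (h - dist o c) (by linarith) (by linarith)
    refine ⟨w, ?_, hC w hwC⟩
    have h3 := hB.head (hC w hwC)
    have h4 := hB.tail (hC w hwC)
    refine mem_iUnion.2 ⟨h, ?_, z, ?_, h4⟩
    · unfold MBtw at h3; linarith
    · rintro rfl; linarith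
  have d1 : 0 < dist z1 z2 := dist_pos.2 hne
  obtain ⟨C, -, -, -, -, hC, hCt⟩ := exists_arc hT z1 z2
  obtain ⟨c, hcC, hc⟩ := hCt (dist z1 z2 / 2) (by linarith) (by linarith)
  have hB := hC c hcC
  have hB' := hB
  unfold MBtw at hB'
  rcases hB.split hT o with h | h
  · obtain ⟨w, hw, hw2⟩ := key c z1 (by rintro rfl; simp at hc; linarith) h.symm'
    exact ⟨w, hw, (hB.symm'.tail hw2 |> fun _ => hw2.symm'.trans_left hB)⟩
  · obtain ⟨w, hw, hw2⟩ := key c z2 (by rintro rfl; linarith) h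
    exact ⟨w, hw, hB.tail hw2⟩

theorem Qset_dense_seg {T : Type*} [MetricSpace T] (hT : IsRealTree T) (o : T) (x y : T)
    (hxy : x ≠ y) (S : Set T) (hS : IsSegment x y S) : S ⊆ closure (Qset o ∩ S) := by
  obtain ⟨a, b, hab, α, hα, rfl, rfl, rfl, -⟩ := hS
  have hab : a < b := lt_of_le_of_ne hab (by rintro rfl; exact hxy rfl)
  rintro _ ⟨c, hc, rfl⟩
  rw [Metric.mem_closure_iff]
  intro δ hδ
  obtain ⟨c1, c2, h1, h12, h2, hc1, hc2⟩ : ∃ c1 c2 : ℝ, a ≤ c1 ∧ c1 < c2 ∧ c2 ≤ b ∧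
      c - δ < c1 ∧ c2 < c + δ := by
    refine ⟨max a (c - δ / 2), min b (c + δ / 2), le_max_left _ _, ?_, min_le_left _ _,
      lt_of_lt_of_le (by linarith) (le_max_right _ _),
      lt_of_le_of_lt (min_le_right _ _) (by linarith)⟩
    have := hc.1
    have := hc.2
    simp only [max_lt_iff, lt_min_iff]
    refine ⟨⟨hab, by linarith⟩, by linarith, by linarith⟩
  have hd : dist (α c1) (α c2) = c2 - c1 := by
    rw [hα c1 ⟨h1, by linarith⟩ c2 ⟨by linarith, h2⟩, abs_of_nonpos (by linarith)]; ring
  obtain ⟨w, hwQ, hw⟩ := exists_mem_Qset hT o (z1 := α c1) (z2 := α c2)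
    (by intro h; rw [h, dist_self] at hd; linarith)
  have hle : dist (α c1) w ≤ c2 - c1 := by
    unfold MBtw at hw
    have := dist_nonneg (x := w) (y := α c2)
    linarith
  have h0 := dist_nonneg (x := α c1) (y := w)
  set s := c1 + dist (α c1) w with hs
  have hsI : s ∈ Icc a b := ⟨by linarith, by linarith⟩
  have hwe : w = α s := by
    refine hw.unique hT (mbtw_of_iso hα h1 (by linarith) (by linarith) h2) ?_
    rw [hα c1 ⟨h1, by linarith⟩ s hsI, abs_of_nonpos (by linarith)]; linarith
  refine ⟨w, ⟨hwQ, s, hsI, hwe.symm⟩, ?_⟩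
  rw [hwe, hα c hc s hsI, abs_lt]
  constructor <;> linarith

theorem isSegment_exists {T : Type*} [MetricSpace T] (hT : IsRealTree T) {x y : T}
    (hxy : x ≠ y) : ∃ S, IsSegment x y S ∧ x ∈ S := by
  obtain ⟨a, b, hab, α, hα, h1, h2, h3⟩ := hT.2.2 x y hxy
  exact ⟨_, ⟨a, b, hab.le, α, hα, h1, h2, rfl, h3⟩, a, ⟨le_rfl, hab.le⟩, h1⟩

theorem hull_compact {T : Type*} [MetricSpace T] (hT : IsRealTree T) (o : T) (K : Set T)
    (hK : IsCompact K) : ∃ Y : Set T, IsCompact Y ∧ IsSubtree Y ∧ K ⊆ Y := by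
  haveI := hT.2.1
  let Y : Set T := {y | y = o ∨ ∃ k ∈ K, MBtw o y k}
  have htb : TotallyBounded Y := by
    rw [Metric.totallyBounded_iff]
    intro ε hε
    obtain ⟨t, ht, htK⟩ := Metric.totallyBounded_iff.1 hK.totallyBounded (ε / 2) (by linarith)
    choose C hC1 hC2 hC3 hC4 hC5 hC6 using fun k => exists_arc hT o k
    have hZ : IsCompact ({o} ∪ ⋃ k ∈ t, C k) :=
      isCompact_singleton.union (ht.isCompact_biUnion fun k _ => hC2 k)
    obtain ⟨t', ht', hcov⟩ := Metric.totallyBounded_iff.1 hZ.totallyBounded (ε / 2) (by linarith)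
    refine ⟨t', ht', ?_⟩
    have main : ∀ y ∈ Y, ∃ z ∈ ({o} ∪ ⋃ k ∈ t, C k : Set T), dist y z < ε / 2 := by
      rintro y (rfl | ⟨k, hk, hB⟩)
      · exact ⟨y, Or.inl rfl, by rw [dist_self]; linarith⟩
      · obtain ⟨k', hk', hkk⟩ := mem_iUnion₂.1 (htK hk)
        rw [mem_ball] at hkk
        rcases hB.split hT k' with h | h
        · refine ⟨y, Or.inr (mem_iUnion₂.2 ⟨k', hk', ?_⟩), by rw [dist_self]; linarith⟩
          have := h
          unfold MBtw at this
          have h0 := dist_nonneg (x := y) (y := k')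
          obtain ⟨w, hw, hwd⟩ := hC6 k' (dist o y) dist_nonneg (by linarith)
          have := (hC5 k' w hw).unique hT h hwd
          rwa [← this]
        · refine ⟨k', Or.inr (mem_iUnion₂.2 ⟨k', hk', hC4 k'⟩), ?_⟩
          unfold MBtw at h
          have h0 := dist_nonneg (x := y) (y := k)
          rw [dist_comm k' k, dist_comm k' y] at h
          linarith
    intro y hy
    obtain ⟨z, hz, hd⟩ := main y hy
    obtain ⟨x, hx, hzx⟩ := mem_iUnion₂.1 (hcov hz)
    rw [mem_ball] at hzx
    refine mem_iUnion₂.2 ⟨x, hx, ?_⟩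
    rw [mem_ball]
    have := dist_triangle y z x
    linarith
  have hpre : IsPreconnected Y := by
    refine isPreconnected_of_forall o ?_
    intro y hy
    obtain ⟨C, hC, -, h1, h2, h3, -⟩ := exists_arc hT o y
    refine ⟨C, ?_, h1, h2, hC⟩
    intro w hw
    rcases hy with rfl | ⟨k, hk, hB⟩
    · left
      have := h3 w hw
      unfold MBtw at this
      rw [dist_self, dist_comm w y] at this
      symm; apply dist_eq_zero.1; linarith
    · exact Or.inr ⟨k, hk, (h3 w hw).trans_left hB⟩
  refine ⟨closure Y, htb.closure.isCompact_of_isClosed isClosed_closure,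
    ⟨⟨o, subset_closure (Or.inl rfl)⟩, isClosed_closure, hpre.closure⟩, ?_⟩
  intro k hk
  exact subset_closure (Or.inr ⟨k, hk, by simp [MBtw]⟩)

/-- In a semi-measured real tree whose branches all have positive measure there is a
countable set dense in every proper segment, and compact subtrees of measure
arbitrarily close to 1. -/
theorem statement15 {T : Type} [MetricSpace T] [m : MeasurableSpace T]
    (hT : IsRealTree T) (μ : Measure T) [IsProbabilityMeasure μ]
    (hballs : ∀ (x : T) (s : ℝ), MeasurableSet (Metric.ball x s))
    (hpos : ∀ B : Set T, IsBranch B → 0 < μ B) :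
    (∃ Q : Set T, Q.Countable ∧
      ∀ x y : T, x ≠ y → ∀ S : Set T, IsSegment x y S → S ⊆ closure (Q ∩ S)) ∧
    ∀ ε : ℝ, 0 < ε → ∃ Y : Set T, IsCompact Y ∧ IsSubtree Y ∧
      1 - ε < (μ Y).toReal := by
  obtain ⟨o⟩ := hT.1
  have hQc := Qset_countable hT μ hballs hpos o
  have hQd := Qset_dense_seg hT o
  refine ⟨⟨Qset o, hQc, hQd⟩, ?_⟩
  haveI := hT.2.1
  haveI : TopologicalSpace.SeparableSpace T := by
    refine ⟨⟨Qset o ∪ {o}, hQc.union (countable_singleton o), ?_⟩⟩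
    intro z
    by_cases hz : z = o
    · exact subset_closure (Or.inr hz)
    · obtain ⟨S, hS, hzS⟩ := isSegment_exists hT hz
      exact closure_mono (inter_subset_left.trans subset_union_left) (hQd z o hz S hS hzS)
  haveI : SecondCountableTopology T := UniformSpace.secondCountable_of_separable T
  haveI : OpensMeasurableSpace T := by
    refine ⟨MeasurableSpace.generateFrom_le ?_⟩
    intro U hU
    obtain ⟨D, hDc, hDd⟩ := TopologicalSpace.exists_countable_dense T
    have hU' : IsOpen U := hU
    have : U = ⋃ x ∈ D, ⋃ q ∈ {q : ℚ | ball x (q : ℝ) ⊆ U}, ball x (q : ℝ) := by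
      apply Subset.antisymm
      · intro u hu
        obtain ⟨δ, hδ, hb⟩ := Metric.isOpen_iff.1 hU' u hu
        obtain ⟨x, hx, hux⟩ := Metric.mem_closure_iff.1 (hDd u) (δ / 3) (by linarith)
        obtain ⟨q, hq1, hq2⟩ := exists_rat_btwn (show δ / 3 < δ / 2 by linarith)
        refine mem_iUnion₂.2 ⟨x, hx, mem_iUnion₂.2 ⟨q, ?_, ?_⟩⟩
        · refine Subset.trans ?_ hb
          apply Metric.ball_subset_ball'
          rw [dist_comm]; linarith
        · rw [mem_ball]; linarith
      · exact iUnion₂_subset fun x hx => iUnion₂_subset fun q hq => hq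
    rw [this]
    exact MeasurableSet.biUnion hDc fun x _ =>
      MeasurableSet.biUnion (Set.to_countable _) fun q _ => hballs x q
  intro ε hε
  have hreg := innerRegularWRT_isCompact_isClosed μ
  obtain ⟨K, -, ⟨hK, -⟩, hμK⟩ := hreg isClosed_univ (ENNReal.ofReal (1 - ε)) (by
    rw [measure_univ, ENNReal.ofReal_lt_one]; linarith)
  obtain ⟨Y, hY, hYs, hKY⟩ := hull_compact hT o K hK
  refine ⟨Y, hY, hYs, ?_⟩
  have := lt_of_lt_of_le hμK (measure_mono hKY)
  rcases le_or_gt 0 (1 - ε) with h | h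
  · exact (ENNReal.ofReal_lt_iff_lt_toReal h (measure_ne_top μ Y)).1 this
  · exact lt_of_lt_of_le h ENNReal.toReal_nonneg

end
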